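/- A sign-symmetric permutation π of degree n has no type-B 231-pattern if and only if for all 1 ≤ i < k ≤ n the following implications hold: (a) if [i] ∈ Cov(π), then [j] ∈ Inv(π) for all 1 ≤ j < i; (b) if (i,k) ∈ Cov(π), then (i,j) ∈ Inv(π) for all i < j < k; (c) if (−k,i) ∈ Cov(π), then [i] ∈ Inv(π), (−j,i) ∈ Inv(π) for all 1 ≤ j < k with j ≠ i, and (−k,j) ∈ Inv(π) for all 1 ≤ j < i. -/

import Mathlib

namespace TypeB

/-- A sign-symmetric permutation of degree `n`: a bijection of `ℤ` with
`π(-i) = -π(i)` which fixes every integer of absolute value `> n`.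
It restricts to a sign-symmetric permutation of `±[n]`. -/
structure SignedPerm (n : ℕ) where
  perm : Equiv.Perm ℤ
  sign_symm : ∀ i : ℤ, perm (-i) = - perm i
  outside : ∀ i : ℤ, (n : ℤ) < |i| → perm i = i

/-- Symbols for type-B inversions: `neg i` is `[i]`, `pair i j` (with `i < j`)
is `(i,j)`, and `mixed i j` (with `i < j`) is `(−j, i)`. -/
inductive BInv (n : ℕ) : Type where
  | neg : ℕ → BInv n
  | pair : ℕ → ℕ → BInv n
  | mixed : ℕ → ℕ → BInv n
deriving DecidableEq

/-- `i⁺`: `i+1` if `i ≠ -1`, and `1` for `i = -1`. -/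
def iplus (i : ℤ) : ℤ := if i = -1 then 1 else i + 1

/-- The inversion set of a sign-symmetric permutation. -/
def Inv {n : ℕ} (π : SignedPerm n) : Set (BInv n) := fun t =>
  match t with
  | .neg i => 1 ≤ i ∧ i ≤ n ∧ π.perm (i : ℤ) < 0
  | .pair i j => 1 ≤ i ∧ i < j ∧ j ≤ n ∧ π.perm (j : ℤ) < π.perm (i : ℤ)
  | .mixed i j => 1 ≤ i ∧ i < j ∧ j ≤ n ∧ π.perm (i : ℤ) + π.perm (j : ℤ) < 0

/-- The cover-inversion set of a sign-symmetric permutation. -/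
def Cov {n : ℕ} (π : SignedPerm n) : Set (BInv n) := fun t =>
  match t with
  | .neg i => 1 ≤ i ∧ i ≤ n ∧ π.perm (i : ℤ) = -1
  | .pair i j => 1 ≤ i ∧ i < j ∧ j ≤ n ∧ π.perm (i : ℤ) = iplus (π.perm (j : ℤ))
  | .mixed i j => 1 ≤ i ∧ i < j ∧ j ≤ n ∧ π.perm (-(j : ℤ)) = iplus (π.perm (i : ℤ))

/-- The symbol `(−j, i)` in canonical form (it equals `(−i, j)`). -/
def mixedInv {n : ℕ} (i j : ℕ) : BInv n := .mixed (min i j) (max i j)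

/-- A type-B composition of `n`: positive parts summing to `n`,
together with a split/join label. -/
structure BComp (n : ℕ) where
  parts : List ℕ
  pos : ∀ a ∈ parts, 0 < a
  sum_eq : parts.sum = n
  isJoin : Bool

/-- The partial sum `p_i = α₁ + ⋯ + α_i`. -/
def pSum {n : ℕ} (α : BComp n) (i : ℕ) : ℕ := (α.parts.take i).sum

/-- The α-region of `a ∈ [n]`: the unique `i` with `p_{i-1} < a ≤ p_i`. -/
def region {n : ℕ} (α : BComp n) (a : ℕ) : ℕ :=
  ((Finset.range α.parts.length).filter (fun j => pSum α j < a)).card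

/-- The first part `α₁` of a type-B composition. -/
def alpha1 {n : ℕ} (α : BComp n) : ℕ := α.parts.headI

/-- Index of the block of `Part(α)` containing `x ∈ ±[n]`; two elements lie in
a common block of `Part(α)` iff their indices agree. -/
def blockIdx {n : ℕ} (α : BComp n) (x : ℤ) : ℤ :=
  if 0 < x then
    (if α.isJoin = true ∧ region α x.toNat = 1 then 0 else (region α x.toNat : ℤ))
  else
    (if α.isJoin = true ∧ region α (-x).toNat = 1 then 0 else -(region α (-x).toNat : ℤ))

/-- Membership in `±[n]`. -/
def inPM (n : ℕ) (x : ℤ) : Prop := x ≠ 0 ∧ -(n : ℤ) ≤ x ∧ x ≤ (n : ℤ)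

/-- `π ∈ H_α`: `π` is increasing on every block of `Part(α)`. -/
def memH {n : ℕ} (α : BComp n) (π : SignedPerm n) : Prop :=
  ∀ a b : ℤ, inPM n a → inPM n b → a < b → blockIdx α a = blockIdx α b →
    π.perm a < π.perm b

/-- Common part of the type-B `(α,231)`- and `(α,312)`-patterns: indices
`i < j < k` in `±[n]`, in pairwise distinct blocks of `Part(α)`, with `j > 0`
and `π(i) = π(k)⁺`. -/
def patternCore {n : ℕ} (α : BComp n) (π : SignedPerm n) (i j k : ℤ) : Prop :=
  inPM n i ∧ inPM n j ∧ inPM n k ∧ i < j ∧ j < k ∧ 0 < j ∧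
  blockIdx α i ≠ blockIdx α j ∧ blockIdx α j ≠ blockIdx α k ∧
  blockIdx α i ≠ blockIdx α k ∧ π.perm i = iplus (π.perm k)

/-- `π` has a type-B `(α,231)`-split (resp. -join) pattern, according to the
label of `α`. -/
def has231 {n : ℕ} (α : BComp n) (π : SignedPerm n) : Prop :=
  ∃ i j k : ℤ, patternCore α π i j k ∧
    (if α.isJoin = true then
       (((alpha1 α : ℤ) < j → π.perm i < π.perm j) ∧
        (j ≤ (alpha1 α : ℤ) → π.perm j < π.perm k))
     else π.perm i < π.perm j)

/-- `π` has a type-B `(α,312)`-split (resp. -join) pattern, according to the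
label of `α`. -/
def has312 {n : ℕ} (α : BComp n) (π : SignedPerm n) : Prop :=
  ∃ i j k : ℤ, patternCore α π i j k ∧
    (if α.isJoin = true then
       (((alpha1 α : ℤ) < j → π.perm j < π.perm k) ∧
        (j ≤ (alpha1 α : ℤ) → π.perm i < π.perm j))
     else π.perm j < π.perm k)

/-- `π ∈ H_α(231)`. -/
def mem231 {n : ℕ} (α : BComp n) (π : SignedPerm n) : Prop := memH α π ∧ ¬ has231 α π

/-- `π ∈ H_α(312)`. -/
def mem312 {n : ℕ} (α : BComp n) (π : SignedPerm n) : Prop := memH α π ∧ ¬ has312 α π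

/-- The set `H_α`. -/
def Hset {n : ℕ} (α : BComp n) : Set (SignedPerm n) := {π | memH α π}

/-- The carrier of `Tam_B(α)`, namely `H_α(231)`. -/
def Tset {n : ℕ} (α : BComp n) : Set (SignedPerm n) := {π | mem231 α π}

/-- The weak order: inclusion of inversion sets. -/
def wle {n : ℕ} (π σ : SignedPerm n) : Prop := Inv π ⊆ Inv σ

/-- `m` is the greatest lower bound of `x` and `y` within `P`, w.r.t. the weak order. -/
def isMeetIn {n : ℕ} (P : Set (SignedPerm n)) (x y m : SignedPerm n) : Prop :=
  m ∈ P ∧ wle m x ∧ wle m y ∧ ∀ z ∈ P, wle z x → wle z y → wle z m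

/-- `u` is the least upper bound of `x` and `y` within `P`, w.r.t. the weak order. -/
def isJoinIn {n : ℕ} (P : Set (SignedPerm n)) (x y u : SignedPerm n) : Prop :=
  u ∈ P ∧ wle x u ∧ wle y u ∧ ∀ z ∈ P, wle x z → wle y z → wle u z

/-- `d = Π↓(π)`: `d` is the greatest element of `{σ ∈ H_α(231) : Inv σ ⊆ Inv π}`. -/
def isProjDown {n : ℕ} (α : BComp n) (π d : SignedPerm n) : Prop :=
  mem231 α d ∧ wle d π ∧ ∀ σ, mem231 α σ → wle σ π → wle σ d

/-- `d = Π†(π)`: `d` is the greatest element of `{σ ∈ H_α(312) : Inv σ ⊆ Inv π}`. -/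
def isProjDagger {n : ℕ} (α : BComp n) (π d : SignedPerm n) : Prop :=
  mem312 α d ∧ wle d π ∧ ∀ σ, mem312 α σ → wle σ π → wle σ d

/-- The value `ω_{o;α}(a)` for `a ∈ [n]`. -/
def omegaPos {n : ℕ} (α : BComp n) (a : ℕ) : ℤ :=
  if α.isJoin = true ∧ region α a = 1 then (a : ℤ)
  else -(((pSum α (region α a) : ℤ) + (pSum α (region α a - 1) : ℤ) + 1) - (a : ℤ))

/-- The longest element `ω_{o;α}` of `H_α`, as a function on `ℤ`. -/
def omegaFun {n : ℕ} (α : BComp n) (x : ℤ) : ℤ :=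
  if 0 < x ∧ x ≤ (n : ℤ) then omegaPos α x.toNat
  else if 0 < -x ∧ -x ≤ (n : ℤ) then -(omegaPos α (-x).toNat)
  else x

/-- The set of `m` such that there is a strict chain `x₀ < x₁ < ⋯ < x_m` in `P`. -/
def chainLengths {n : ℕ} (P : Set (SignedPerm n)) : Set ℕ :=
  {m | ∃ f : Fin (m + 1) → SignedPerm n, (∀ i, f i ∈ P) ∧
        ∀ i j : Fin (m + 1), i < j → Inv (f i) ⊂ Inv (f j)}

/-- `x` is join-irreducible in `Tam_B(α)`. -/
def joinIrred {n : ℕ} (α : BComp n) (x : SignedPerm n) : Prop :=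
  x ∈ Tset α ∧ ¬ (∀ y ∈ Tset α, wle x y) ∧
  ∀ y z, y ∈ Tset α → z ∈ Tset α → isJoinIn (Tset α) y z x → x = y ∨ x = z

/-- `x` is meet-irreducible in `Tam_B(α)`. -/
def meetIrred {n : ℕ} (α : BComp n) (x : SignedPerm n) : Prop :=
  x ∈ Tset α ∧ ¬ (∀ y ∈ Tset α, wle y x) ∧
  ∀ y z, y ∈ Tset α → z ∈ Tset α → isMeetIn (Tset α) y z x → x = y ∨ x = z

/-- `x` is left modular in the lattice on `P`: `(r ∨ x) ∧ q = r ∨ (x ∧ q)`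
for all `r ≤ q` in `P`. -/
def leftModular {n : ℕ} (P : Set (SignedPerm n)) (x : SignedPerm n) : Prop :=
  ∀ r q, r ∈ P → q ∈ P → wle r q →
    ∀ u v w1 w2, isJoinIn P r x u → isMeetIn P u q v →
      isMeetIn P x q w1 → isJoinIn P r w1 w2 → v = w2

/-- The simple generator `s_i` as a function on `ℤ`: `s₀` exchanges `1` and `-1`,
and for `i ≥ 1`, `s_i` exchanges `i` with `i+1` and `-i` with `-(i+1)`. -/
def sfun (i : ℕ) (x : ℤ) : ℤ :=
  if i = 0 then (if x = 1 then -1 else if x = -1 then 1 else x)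
  else if x = (i : ℤ) then (i : ℤ) + 1
  else if x = (i : ℤ) + 1 then (i : ℤ)
  else if x = -(i : ℤ) then -(i : ℤ) - 1
  else if x = -(i : ℤ) - 1 then -(i : ℤ)
  else x

/-- `i` is one of the partial sums `p₁, …, p_{r−1}` of `α`. -/
def isPSum {n : ℕ} (α : BComp n) (i : ℕ) : Prop :=
  ∃ j : ℕ, 1 ≤ j ∧ j < α.parts.length ∧ pSum α j = i

/-- `n² − Σᵢ α_i(α_i−1)/2`, minus additionally `(α₁+1)α₁/2` when `α` is join. -/
def lengthFormula {n : ℕ} (α : BComp n) : ℕ :=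
  n ^ 2 - (α.parts.map (fun a => a * (a - 1) / 2)).sum -
    (if α.isJoin = true then (alpha1 α + 1) * alpha1 α / 2 else 0)

/-- `π` has a type-B `231`-pattern: indices `−n ≤ i < j < k ≤ n` with
`j, k > 0`, `π(i) = π(k)⁺` and `π(j) > π(i)`. -/
def has231B {n : ℕ} (π : SignedPerm n) : Prop :=
  ∃ i j k : ℤ, inPM n i ∧ inPM n j ∧ inPM n k ∧ i < j ∧ j < k ∧
    0 < j ∧ 0 < k ∧ π.perm i = iplus (π.perm k) ∧ π.perm i < π.perm j

namespace SignedPerm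

variable {n : ℕ} (π : SignedPerm n)

theorem perm_ne_zero {x : ℤ} (hx : x ≠ 0) : π.perm x ≠ 0 := by
  have h0 : π.perm 0 = 0 := by
    have := π.sign_symm 0
    simp only [neg_zero] at this
    omega
  intro h
  exact hx (π.perm.injective (h.trans h0.symm))

/-- The cover relation described by `(−k, i)` is symmetric in `i` and `k`. -/
theorem perm_neg_eq_iplus_symm {i k : ℤ} (hi : i ≠ 0) (hk : k ≠ 0) (hne : i ≠ k)
    (h : π.perm (-k) = iplus (π.perm i)) : π.perm (-i) = iplus (π.perm k) := by
  have h1 := π.perm_ne_zero hi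
  have h2 := π.perm_ne_zero hk
  have h3 : π.perm i ≠ π.perm k := fun e => hne (π.perm.injective e)
  rw [π.sign_symm] at h ⊢
  unfold iplus at *
  split_ifs at * <;> omega

/-- The cover relation described by `[i]` says that `π(i) = −1`. -/
theorem perm_neg_self_eq_iplus_iff (i : ℤ) :
    π.perm (-i) = iplus (π.perm i) ↔ π.perm i = -1 := by
  rw [π.sign_symm]
  unfold iplus
  split_ifs <;> omega

/-- Without a `231`-pattern, every middle entry stays below a cover. -/
theorem perm_lt_of_not_has231B (hp : ¬ has231B π) {i j k : ℤ} (hi : i ≠ 0)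
    (hin : -(n : ℤ) ≤ i) (hij : i < j) (hj : 0 < j) (hjk : j < k) (hk : k ≤ n)
    (hc : π.perm i = iplus (π.perm k)) : π.perm j < π.perm i := by
  have hne : π.perm j ≠ π.perm i := fun e => hij.ne' (π.perm.injective e)
  by_contra hlt
  refine hp ⟨i, j, k, ⟨hi, hin, ?_⟩, ⟨hj.ne', ?_, ?_⟩, ⟨?_, ?_, hk⟩, hij, hjk, hj,
    hj.trans hjk, hc, ?_⟩ <;> omega

end SignedPerm

/-- A sign-symmetric permutation `π` has no type-B
`231`-pattern iff: (a) `[i] ∈ Cov(π)` forces `[j] ∈ Inv(π)` for all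
`1 ≤ j < i`; (b) `(i,k) ∈ Cov(π)` forces `(i,j) ∈ Inv(π)` for all `i < j < k`;
(c) `(−k,i) ∈ Cov(π)` forces `[i] ∈ Inv(π)`, `(−j,i) ∈ Inv(π)` for all
`1 ≤ j < k` with `j ≠ i`, and `(−k,j) ∈ Inv(π)` for all `1 ≤ j < i`. -/
theorem no_type_b_231_iff_forcing (n : ℕ) (hn : 1 ≤ n) (π : SignedPerm n) :
    ¬ has231B π ↔
      ((∀ i : ℕ, BInv.neg i ∈ Cov π →
          ∀ j : ℕ, 1 ≤ j → j < i → BInv.neg j ∈ Inv π) ∧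
       (∀ i k : ℕ, BInv.pair i k ∈ Cov π →
          ∀ j : ℕ, i < j → j < k → BInv.pair i j ∈ Inv π) ∧
       (∀ i k : ℕ, BInv.mixed i k ∈ Cov π →
          BInv.neg i ∈ Inv π ∧
          (∀ j : ℕ, 1 ≤ j → j < k → j ≠ i → mixedInv i j ∈ Inv π) ∧
          (∀ j : ℕ, 1 ≤ j → j < i → BInv.mixed j k ∈ Inv π))) := by
  constructor
  · intro hp
    refine ⟨?_, ?_, ?_⟩
    · rintro i ⟨hi, hin, hc⟩ j hj hji
      have h := π.perm_lt_of_not_has231B hp (i := -i) (j := j) (k := i) (by omega) (by omega)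
        (by omega) (by omega) (by omega) (by omega) ((π.perm_neg_self_eq_iplus_iff i).2 hc)
      have hne := π.perm_ne_zero (x := j) (by omega)
      rw [π.sign_symm] at h
      exact ⟨hj, by omega, by omega⟩
    · rintro i k ⟨hi, hik, hkn, hc⟩ j hij hjk
      exact ⟨hi, hij, by omega, π.perm_lt_of_not_has231B hp (k := k) (by omega) (by omega)
        (by omega) (by omega) (by omega) (by omega) hc⟩
    · rintro i k ⟨hi, hik, hkn, hc⟩
      have hc' := π.perm_neg_eq_iplus_symm (by omega) (by omega) (by omega) hc
      have key : ∀ j : ℕ, 1 ≤ j → j < k → π.perm j < -π.perm i := fun j hj hjk => by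
        rw [← π.sign_symm]
        exact π.perm_lt_of_not_has231B hp (k := k) (by omega) (by omega) (by omega) (by omega)
          (by omega) (by omega) hc'
      refine ⟨⟨hi, by omega, ?_⟩, fun j hj hjk hji => ?_, fun j hj hji => ?_⟩
      · have := key i hi hik
        omega
      · have := key j hj hjk
        refine ⟨by omega, by omega, by omega, ?_⟩
        rcases le_total i j with h | h
        · rw [min_eq_left h, max_eq_right h]
          omega
        · rw [min_eq_right h, max_eq_left h]
          omega
      · have h := π.perm_lt_of_not_has231B hp (i := -k) (j := j) (k := i) (by omega) (by omega)
          (by omega) (by omega) (by omega) (by omega) hc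
        rw [π.sign_symm] at h
        exact ⟨hj, by omega, hkn, by omega⟩
  · rintro ⟨ha, hb, hm⟩ ⟨i, j, k, ⟨hi, hin, -⟩, -, ⟨-, -, hkn⟩, hij, hjk, hj, hk, hc, hlt⟩
    lift k to ℕ using hk.le
    lift j to ℕ using hj.le
    rcases lt_or_gt_of_ne hi with hneg | hpos
    · obtain ⟨a, rfl⟩ : ∃ a : ℕ, i = -(a : ℤ) := ⟨i.natAbs, by omega⟩
      have hsymm := π.sign_symm a
      rcases lt_trichotomy a k with hak | rfl | hka
      · have hc' := π.perm_neg_eq_iplus_symm (by omega) (by omega) (by omega) hc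
        obtain ⟨⟨-, -, hself⟩, hmid, -⟩ := hm a k ⟨by omega, hak, by omega, hc'⟩
        by_cases hja : j = a
        · subst hja
          omega
        · obtain ⟨-, -, -, h⟩ := hmid j (by omega) (by omega) hja
          rcases le_total a j with h' | h'
          · rw [min_eq_left h', max_eq_right h'] at h
            omega
          · rw [min_eq_right h', max_eq_left h'] at h
            omega
      · have hc' := (π.perm_neg_self_eq_iplus_iff a).1 hc
        obtain ⟨-, -, h⟩ := ha a ⟨by omega, by omega, hc'⟩ j (by omega) (by omega)
        omega
      · obtain ⟨-, -, hlow⟩ := hm k a ⟨by omega, hka, by omega, hc⟩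
        obtain ⟨-, -, -, h⟩ := hlow j (by omega) (by omega)
        omega
    · lift i to ℕ using hpos.le
      obtain ⟨-, -, -, h⟩ := hb i k ⟨by omega, by omega, by omega, hc⟩ j (by omega) (by omega)
      omega

end TypeB
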